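/- For any two ordered plantings S and T, ⟨D̂_S, D̂_T⟩ ≤ p²·(2^{Λ(S,T)} − 1)/t², and consequently ⟨D̂_S, D̂_T⟩ ≤ (k²/n²)·2^{Λ(S,T)}. -/

import Mathlib

open Finset

/-- An ordered planting: `t` pairwise disjoint `k`-element subsets of `[n]`. -/
def IsPlanting (n k t : ℕ) (S : Fin t → Finset (Fin n)) : Prop :=
  (∀ i, (S i).card = k) ∧ ∀ i j : Fin t, i ≠ j → Disjoint (S i) (S j)

/-- The planted distribution `𝖣_S` on `{0,1}ⁿ`:
`𝖣_S(x) = (1 − p)·2^{−n} + (p/t)·∑_i 2^{−(n−k)}·1[x_v = 1 ∀ v ∈ S_i]` with `p = kt/n`. -/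
noncomputable def DS (n k t : ℕ) (S : Fin t → Finset (Fin n)) (x : Fin n → Bool) : ℝ :=
  (1 - (k * t : ℝ) / n) * (2 : ℝ)⁻¹ ^ n +
    ((k * t : ℝ) / n) / t *
      ∑ i : Fin t, (2 : ℝ)⁻¹ ^ (n - k) * (if ∀ v ∈ S i, x v = true then 1 else 0)

/-- `D̂_S(x) = 𝖣_S(x)/𝒟₀(x) − 1` where `𝒟₀` is uniform on `{0,1}ⁿ`. -/
noncomputable def Dhat (n k t : ℕ) (S : Fin t → Finset (Fin n)) (x : Fin n → Bool) : ℝ :=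
  DS n k t S x / (2 : ℝ)⁻¹ ^ n - 1

/-- `⟨f,g⟩ = 2^{−n} ∑_{x ∈ {0,1}ⁿ} f(x) g(x)`. -/
noncomputable def innerD (n : ℕ) (f g : (Fin n → Bool) → ℝ) : ℝ :=
  (2 : ℝ)⁻¹ ^ n * ∑ x : Fin n → Bool, f x * g x

/-- `Λ(S,T) = ∑_{i,j} |S_i ∩ T_j|`. -/
def Lam {n t : ℕ} (S T : Fin t → Finset (Fin n)) : ℕ :=
  ∑ i : Fin t, ∑ j : Fin t, (S i ∩ T j).card

theorem card_filter_forall_mem_eq_true {ι : Type*} [Fintype ι] [DecidableEq ι] (A : Finset ι)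
    [DecidablePred fun x : ι → Bool => ∀ v ∈ A, x v = true] :
    (univ.filter fun x : ι → Bool => ∀ v ∈ A, x v = true).card * 2 ^ A.card =
      2 ^ Fintype.card ι := by
  have h : (univ.filter fun x : ι → Bool => ∀ v ∈ A, x v = true) =
      Fintype.piFinset fun v => if v ∈ A then {true} else univ := by
    ext x
    simp only [mem_filter, mem_univ, true_and, Fintype.mem_piFinset]
    refine forall_congr' fun v => ?_
    by_cases hv : v ∈ A <;> simp [hv]
  rw [h, Fintype.card_piFinset, ← prod_const, ← Fintype.prod_ite_mem A, ← prod_mul_distrib,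
    Fintype.card, ← prod_const]
  refine prod_congr rfl fun v _ => ?_
  by_cases hv : v ∈ A <;> simp [hv]

theorem mean_indicator (n : ℕ) (A : Finset (Fin n)) :
    (2 : ℝ)⁻¹ ^ n * ∑ x : Fin n → Bool, (if ∀ v ∈ A, x v = true then (1 : ℝ) else 0) =
      (2 : ℝ)⁻¹ ^ A.card := by
  have h := card_filter_forall_mem_eq_true A
  rw [Fintype.card_fin] at h
  have h' : ((univ.filter fun x : Fin n → Bool => ∀ v ∈ A, x v = true).card : ℝ) *
      2 ^ A.card = 2 ^ n := by exact_mod_cast h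
  rw [sum_boole, inv_pow, inv_pow]
  field_simp
  exact h'

/-- The density, relative to the uniform distribution and centred at zero, of the uniform
distribution conditioned on all coordinates in `A` being `true`. -/
noncomputable def centredDensity {n : ℕ} (A : Finset (Fin n)) (x : Fin n → Bool) : ℝ :=
  2 ^ A.card * (if ∀ v ∈ A, x v = true then 1 else 0) - 1

theorem innerD_centredDensity (n : ℕ) (A B : Finset (Fin n)) :
    innerD n (centredDensity A) (centredDensity B) = 2 ^ (A ∩ B).card - 1 := by
  have hmul (x : Fin n → Bool) : centredDensity A x * centredDensity B x =
      2 ^ A.card * 2 ^ B.card * (if ∀ v ∈ A ∪ B, x v = true then (1 : ℝ) else 0) -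
        2 ^ A.card * (if ∀ v ∈ A, x v = true then (1 : ℝ) else 0) -
        2 ^ B.card * (if ∀ v ∈ B, x v = true then (1 : ℝ) else 0) +
        (if ∀ v ∈ (∅ : Finset (Fin n)), x v = true then (1 : ℝ) else 0) := by
    have hu : (∀ v ∈ A ∪ B, x v = true) ↔
        (∀ v ∈ A, x v = true) ∧ ∀ v ∈ B, x v = true := forall_mem_union
    simp only [centredDensity, hu, notMem_empty, false_imp_iff, implies_true, if_true]
    split_ifs <;> first | tauto | ring
  have hcancel (m : ℕ) : (2 : ℝ) ^ m * (2 : ℝ)⁻¹ ^ m = 1 := by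
    rw [← mul_pow]; norm_num
  have hunion : (2 : ℝ) ^ A.card * 2 ^ B.card * (2 : ℝ)⁻¹ ^ (A ∪ B).card =
      2 ^ (A ∩ B).card := by
    rw [← pow_add, ← card_union_add_card_inter, pow_add, mul_right_comm, hcancel, one_mul]
  simp only [innerD, hmul, sum_add_distrib, sum_sub_distrib, ← mul_sum]
  have hempty := mean_indicator n ∅
  rw [card_empty, pow_zero] at hempty
  linear_combination (2 : ℝ) ^ A.card * 2 ^ B.card * mean_indicator n (A ∪ B) -
    (2 : ℝ) ^ A.card * mean_indicator n A - (2 : ℝ) ^ B.card * mean_indicator n B +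
    hempty + hunion - hcancel A.card - hcancel B.card

theorem Dhat_eq_sum_centredDensity {n k t : ℕ} (ht : 0 < t) (hkt : k * t ≤ n)
    {S : Fin t → Finset (Fin n)} (hS : IsPlanting n k t S) (x : Fin n → Bool) :
    Dhat n k t S x = ((k * t : ℝ) / n) / t * ∑ i, centredDensity (S i) x := by
  have hkn : k ≤ n := (Nat.le_mul_of_pos_right k ht).trans hkt
  have hpow : (2 : ℝ)⁻¹ ^ (n - k) = 2 ^ k * (2 : ℝ)⁻¹ ^ n := by
    rw [← Nat.sub_add_cancel hkn, pow_add, Nat.add_sub_cancel, mul_left_comm, ← mul_pow]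
    norm_num
  have ht' : (t : ℝ) ≠ 0 := by positivity
  simp only [Dhat, DS, centredDensity, hS.1, hpow, sum_sub_distrib, ← mul_sum, sum_const,
    card_univ, Fintype.card_fin, nsmul_eq_mul, mul_one]
  have h2 : (2 : ℝ)⁻¹ ^ n ≠ 0 := by positivity
  generalize (2 : ℝ)⁻¹ ^ n = c at *
  generalize (k * t : ℝ) / n = p
  field_simp
  ring

theorem innerD_mul_sum (n : ℕ) {ι κ : Type*} [Fintype ι] [Fintype κ] (c : ℝ)
    (f : ι → (Fin n → Bool) → ℝ) (g : κ → (Fin n → Bool) → ℝ) :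
    innerD n (fun x => c * ∑ i, f i x) (fun x => c * ∑ j, g j x) =
      c ^ 2 * ∑ i, ∑ j, innerD n (f i) (g j) := by
  have h (x : Fin n → Bool) : (c * ∑ i, f i x) * (c * ∑ j, g j x) =
      c ^ 2 * ∑ i, ∑ j, f i x * g j x := by
    rw [← sum_mul_sum]; ring
  simp only [innerD, h]
  rw [← mul_sum, sum_comm, mul_left_comm]
  congr 1
  rw [mul_sum]
  refine sum_congr rfl fun i _ => ?_
  rw [sum_comm, mul_sum]

theorem sum_two_pow_sub_one_le {ι : Type*} (s : Finset ι) (f : ι → ℕ) :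
    ∑ i ∈ s, ((2 : ℝ) ^ f i - 1) ≤ 2 ^ (∑ i ∈ s, f i) - 1 := by
  classical
  induction s using Finset.induction_on with
  | empty => simp
  | insert a s ha ih =>
    rw [sum_insert ha, sum_insert ha, pow_add]
    have h1 : (1 : ℝ) ≤ 2 ^ f a := one_le_pow₀ one_le_two
    have h2 : (1 : ℝ) ≤ 2 ^ ∑ i ∈ s, f i := one_le_pow₀ one_le_two
    nlinarith [mul_nonneg (sub_nonneg.2 h1) (sub_nonneg.2 h2)]

/-- For any two ordered plantings `S`, `T`,
`⟨D̂_S, D̂_T⟩ ≤ p² (2^{Λ(S,T)} − 1)/t²`, and consequently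
`⟨D̂_S, D̂_T⟩ ≤ (k²/n²)·2^{Λ(S,T)}`. -/
theorem pairwise_correlation_bound (n k t : ℕ) (hn : 0 < n) (hk : 0 < k) (ht : 0 < t)
    (hkt : k * t ≤ n) (S T : Fin t → Finset (Fin n))
    (hS : IsPlanting n k t S) (hT : IsPlanting n k t T) :
    innerD n (Dhat n k t S) (Dhat n k t T) ≤
        ((k * t : ℝ) / n) ^ 2 * ((2 : ℝ) ^ (Lam S T) - 1) / (t : ℝ) ^ 2 ∧
      innerD n (Dhat n k t S) (Dhat n k t T) ≤
        ((k : ℝ) ^ 2 / (n : ℝ) ^ 2) * (2 : ℝ) ^ (Lam S T) := by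
  have hsum : ∑ i, ∑ j, ((2 : ℝ) ^ (S i ∩ T j).card - 1) ≤ 2 ^ Lam S T - 1 :=
    (sum_le_sum fun i _ => sum_two_pow_sub_one_le univ fun j => (S i ∩ T j).card).trans
      (sum_two_pow_sub_one_le univ _)
  have hfirst : innerD n (Dhat n k t S) (Dhat n k t T) ≤
      ((k * t : ℝ) / n) ^ 2 * ((2 : ℝ) ^ (Lam S T) - 1) / (t : ℝ) ^ 2 := by
    rw [funext (Dhat_eq_sum_centredDensity ht hkt hS),
      funext (Dhat_eq_sum_centredDensity ht hkt hT), innerD_mul_sum]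
    simp only [innerD_centredDensity]
    rw [div_pow _ (t : ℝ), mul_div_right_comm (_ ^ 2)]
    gcongr
  refine ⟨hfirst, hfirst.trans ?_⟩
  have ht' : (t : ℝ) ≠ 0 := by positivity
  have hcoeff : ((k * t : ℝ) / n) ^ 2 * ((2 : ℝ) ^ (Lam S T) - 1) / (t : ℝ) ^ 2 =
      (k : ℝ) ^ 2 / (n : ℝ) ^ 2 * ((2 : ℝ) ^ (Lam S T) - 1) := by
    field_simp
  rw [hcoeff]
  gcongr
  exact sub_le_self _ zero_le_one
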